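/- Let 𝓑 = {t ∈ {1,…,T} : ⟨c_t, h_t⟩ < α‖c_t‖²} be the set of rounds with bad hints. Then the hint-querying algorithm satisfies: sup over ‖u‖ ≤ 1 of Σ_{t=1}^T [ p_t·⟨c_t, −h_t⟩ + (1−p_t)·⟨c_t, x_t⟩ − ⟨c_t, u⟩ ] is at most (78 + 38·log(1 + σ_{1:T}))/α + 40·√(Σ_{t∈𝓑} ‖c_t‖²) + (20/α)·√(Σ_{t∈𝓑} ‖h_t‖²)·√(log(1 + σ_{1:T})); moreover Σ_{t=1}^T p_t·α‖c_t‖² ≤ 20·√(σ_{1:T}). -/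

import Mathlib

open RealInnerProductSpace

/-- Vectors in `ℝ^d` with the Euclidean structure. -/
abbrev Vec (d : ℕ) := EuclideanSpace ℝ (Fin d)

/-! ### Scalar facts -/

/-- If the increments of `A` are bounded by those of `g`, so are the total changes. -/
lemma sub_le_sub_of_step_le {A g : ℕ → ℝ} {m n : ℕ} (hmn : m ≤ n)
    (hstep : ∀ t, m ≤ t → t < n → A (t + 1) - A t ≤ g (t + 1) - g t) :
    A n - A m ≤ g n - g m := by
  induction n, hmn using Nat.le_induction with
  | base => simp
  | succ k hk ih =>
    have h1 := ih fun t h1 h2 => hstep t h1 (by omega)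
    have h2 := hstep k hk (by omega)
    linarith

lemma div_add_le_log_sub_log {V s : ℝ} (hV : 0 < V) (hs : 0 ≤ s) :
    s / (V + s) ≤ Real.log (V + s) - Real.log V := by
  have h := Real.one_sub_inv_le_log_of_pos (x := (V + s) / V) (by positivity)
  rw [Real.log_div (by positivity) hV.ne'] at h
  have h2 : s / (V + s) = 1 - ((V + s) / V)⁻¹ := by
    field_simp
    ring
  linarith

lemma div_le_two_mul_log_sub_log {V s : ℝ} (hV : 1 ≤ V) (hs : 0 ≤ s) (hs1 : s ≤ 1) :
    s / V ≤ 2 * (Real.log (V + s) - Real.log V) := by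
  have h := div_add_le_log_sub_log (V := V) (by linarith) hs
  have h2 : s / V ≤ 2 * (s / (V + s)) := by
    rw [← mul_div_assoc, div_le_div_iff₀ (by linarith) (by linarith)]
    nlinarith
  linarith

lemma div_sqrt_le_three_mul_sqrt_sub_sqrt {V s : ℝ} (hV : 1 ≤ V) (hs : 0 ≤ s) (hs1 : s ≤ 1) :
    s / √V ≤ 3 * (√(V + s) - √V) := by
  have hpos : 0 < √V := Real.sqrt_pos.2 (by linarith)
  have h1 : √V ^ 2 = V := Real.sq_sqrt (by linarith)
  have h2 : √(V + s) ^ 2 = V + s := Real.sq_sqrt (by linarith)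
  have h3 : √V ≤ √(V + s) := Real.sqrt_le_sqrt (by linarith)
  have h4 : √(V + s) ≤ 2 * √V := by
    apply abs_le_of_sq_le_sq' _ (by positivity) |>.2
    nlinarith
  rw [div_le_iff₀ hpos]
  nlinarith

lemma div_sqrt_le_two_mul_sqrt_sub_sqrt {V b s : ℝ} (hV : 0 < V) (hb : 0 ≤ b) (hs : 0 ≤ s)
    (hbV : b + s ≤ V) : s / √V ≤ 2 * (√(b + s) - √b) := by
  have hpos : 0 < √V := Real.sqrt_pos.2 hV
  have h1 : √b ^ 2 = b := Real.sq_sqrt hb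
  have h2 : √(b + s) ^ 2 = b + s := Real.sq_sqrt (by linarith)
  have h3 : √b ≤ √(b + s) := Real.sqrt_le_sqrt (by linarith)
  have h4 : √(b + s) ≤ √V := Real.sqrt_le_sqrt hbV
  rw [div_le_iff₀ hpos]
  nlinarith [mul_nonneg (sub_nonneg.2 h3) (sub_nonneg.2 h4)]

/-- Projecting onto `[0, D]` does not increase the distance to points of `[0, D]`. -/
lemma sq_clip_sub_le {D a q : ℝ} (hq0 : 0 ≤ q) (hqD : q ≤ D) :
    (max 0 (min D a) - q) ^ 2 ≤ (a - q) ^ 2 := by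
  rcases le_total D a with h | h
  · rw [min_eq_left h, max_eq_right (by linarith)]
    nlinarith
  · rw [min_eq_right h]
    rcases le_total 0 a with h' | h'
    · rw [max_eq_right h']
    · rw [max_eq_left h']
      nlinarith

lemma exists_last {P : ℕ → Prop} (h0 : P 0) (n : ℕ) :
    ∃ τ ≤ n, P τ ∧ ∀ t, τ < t → t ≤ n → ¬ P t := by
  classical
  exact ⟨Nat.findGreatest P n, Nat.findGreatest_le n, Nat.findGreatest_spec (Nat.zero_le n) h0,
    fun t h1 h2 => Nat.findGreatest_is_greatest h1 h2⟩

/-! ### Regularized linear minimization over the unit ball -/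

section Ball

variable {E : Type*} [NormedAddCommGroup E] [InnerProductSpace ℝ E]

/-- `x` minimizes `⟨G, ·⟩ + w/2 ‖·‖²` over the closed unit ball. -/
def IsBallMin (G : E) (w : ℝ) (x : E) : Prop :=
  ‖x‖ ≤ 1 ∧ ∀ y : E, ‖y‖ ≤ 1 → ⟪G, x⟫ + w / 2 * ‖x‖ ^ 2 ≤ ⟪G, y⟫ + w / 2 * ‖y‖ ^ 2

lemma IsBallMin.add_sq_le {G x : E} {w : ℝ} (hx : IsBallMin G w x) (hw : 0 ≤ w) {y : E}
    (hy : ‖y‖ ≤ 1) :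
    ⟪G, x⟫ + w / 2 * ‖x‖ ^ 2 + w / 2 * ‖y - x‖ ^ 2 ≤ ⟪G, y⟫ + w / 2 * ‖y‖ ^ 2 := by
  obtain ⟨hx1, hmin⟩ := hx
  obtain ⟨v, rfl⟩ : ∃ v, y = x + v := ⟨y - x, by abel⟩
  have key : ∀ θ : ℝ, ⟪G, x + θ • v⟫ + w / 2 * ‖x + θ • v‖ ^ 2
      = ⟪G, x⟫ + w / 2 * ‖x‖ ^ 2 + θ * (⟪G, v⟫ + w * ⟪x, v⟫) + θ ^ 2 * (w / 2 * ‖v‖ ^ 2) := by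
    intro θ
    rw [norm_add_sq_real, inner_add_right, inner_smul_right, inner_smul_right, norm_smul,
      mul_pow, Real.norm_eq_abs, sq_abs]
    ring
  have h1 := key 1
  rw [one_smul] at h1
  rw [add_sub_cancel_left, h1]
  suffices 0 ≤ ⟪G, v⟫ + w * ⟪x, v⟫ by linarith
  by_contra! hA
  set A := ⟪G, v⟫ + w * ⟪x, v⟫
  set N := w / 2 * ‖v‖ ^ 2
  have hN : 0 ≤ N := by positivity
  have hden : 0 < 2 * N - A := by linarith
  have hθ0 : 0 < -A / (2 * N - A) := div_pos (by linarith) hden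
  have hθ1 : -A / (2 * N - A) ≤ 1 := by
    rw [div_le_one hden]
    linarith
  have hθN : -A / (2 * N - A) * (2 * N - A) = -A := div_mul_cancel₀ _ hden.ne'
  set θ := -A / (2 * N - A)
  have hball : ‖x + θ • v‖ ≤ 1 := by
    have h2 : x + θ • v = (1 - θ) • x + θ • (x + v) := by
      rw [sub_smul, smul_add, one_smul]
      abel
    rw [h2]
    calc ‖(1 - θ) • x + θ • (x + v)‖ ≤ ‖(1 - θ) • x‖ + ‖θ • (x + v)‖ := norm_add_le _ _
      _ = (1 - θ) * ‖x‖ + θ * ‖x + v‖ := by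
        rw [norm_smul, norm_smul, Real.norm_of_nonneg (by linarith), Real.norm_of_nonneg hθ0.le]
      _ ≤ 1 := by nlinarith
  have h3 := hmin _ hball
  rw [key] at h3
  have h4 : 0 ≤ θ * (A + θ * N) := by linarith
  have h5 : 0 ≤ A + θ * N := nonneg_of_mul_nonneg_right h4 hθ0
  nlinarith

lemma exists_unit_inner_eq_neg_norm (G : E) : ∃ y : E, ‖y‖ ≤ 1 ∧ ⟪G, y⟫ = -‖G‖ := by
  rcases eq_or_ne G 0 with rfl | hG
  · exact ⟨0, by simp⟩
  · have hG' : ‖G‖ ≠ 0 := norm_ne_zero_iff.2 hG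
    refine ⟨(-‖G‖⁻¹) • G, ?_, ?_⟩
    · rw [norm_smul, norm_neg, norm_inv, norm_norm, inv_mul_cancel₀ hG']
    · rw [inner_smul_right, real_inner_self_eq_norm_sq]
      field_simp

lemma neg_norm_le_inner {G y : E} (hy : ‖y‖ ≤ 1) : -‖G‖ ≤ ⟪G, y⟫ := by
  have h1 := abs_le.1 (abs_real_inner_le_norm G y)
  nlinarith [norm_nonneg G, norm_nonneg y, h1.1]

lemma IsBallMin.value_le {G x : E} {w : ℝ} (hx : IsBallMin G w x) (hw : 0 ≤ w) :
    ⟪G, x⟫ + w / 2 * ‖x‖ ^ 2 ≤ -‖G‖ + w / 2 := by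
  obtain ⟨y, hy, hGy⟩ := exists_unit_inner_eq_neg_norm G
  have h1 := hx.2 y hy
  have h2 : ‖y‖ ^ 2 ≤ 1 := pow_le_one₀ (norm_nonneg y) hy
  rw [hGy] at h1
  nlinarith

/-- The value of the regularized problem controls the loss incurred at the minimizer. -/
lemma IsBallMin.inner_le {G c x x' : E} {w w' : ℝ} (hx : IsBallMin G w x)
    (hx' : IsBallMin (G + c) w' x') (hw : 0 < w) (hww' : w ≤ w') :
    ⟪c, x⟫ ≤ (⟪G + c, x'⟫ + w' / 2 * ‖x'‖ ^ 2) - (⟪G, x⟫ + w / 2 * ‖x‖ ^ 2)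
      + ‖c‖ ^ 2 / (2 * w) := by
  have h1 := hx.add_sq_le hw.le hx'.1
  have h2 : -(‖c‖ * ‖x' - x‖) ≤ ⟪c, x' - x⟫ := (abs_le.1 (abs_real_inner_le_norm c (x' - x))).1
  have h3 : ‖c‖ * ‖x' - x‖ ≤ ‖c‖ ^ 2 / (2 * w) + w / 2 * ‖x' - x‖ ^ 2 := by
    have h4 : ‖c‖ ^ 2 / (2 * w) + w / 2 * ‖x' - x‖ ^ 2 - ‖c‖ * ‖x' - x‖
        = (‖c‖ - w * ‖x' - x‖) ^ 2 / (2 * w) := by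
      field_simp
      ring
    have h5 : 0 ≤ (‖c‖ - w * ‖x' - x‖) ^ 2 / (2 * w) := by positivity
    linarith
  rw [inner_sub_right] at h2
  rw [inner_add_left]
  nlinarith [sq_nonneg ‖x'‖]

lemma IsBallMin.le_inner {G c x x' : E} {w w' : ℝ} (hx : IsBallMin G w x)
    (hx' : IsBallMin (G + c) w' x') (hww' : w ≤ w') :
    (⟪G + c, x'⟫ + w' / 2 * ‖x'‖ ^ 2) - (⟪G, x⟫ + w / 2 * ‖x‖ ^ 2) - (w' - w) / 2 ≤ ⟪c, x⟫ := by
  have h1 := hx'.2 x hx.1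
  have h2 : ‖x‖ ^ 2 ≤ 1 := pow_le_one₀ (norm_nonneg x) hx.1
  rw [inner_add_left G c x] at h1
  nlinarith

/-- If the linear part dominates the regularizer, the minimizer is `-G / ‖G‖`. -/
lemma IsBallMin.eq_neg_smul {G x : E} {w : ℝ} (hx : IsBallMin G w x) (hw : 0 < w)
    (hG : w ≤ ‖G‖) : x = (-‖G‖⁻¹) • G := by
  have hG' : ‖G‖ ≠ 0 := by linarith
  have hn : ‖(-‖G‖⁻¹) • G‖ = 1 := by
    rw [norm_smul, norm_neg, norm_inv, norm_norm, inv_mul_cancel₀ hG']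
  have hi : ⟪G, (-‖G‖⁻¹) • G⟫ = -‖G‖ := by
    rw [inner_smul_right, real_inner_self_eq_norm_sq]
    field_simp
  have h1 := hx.add_sq_le hw.le hn.le
  rw [hn, hi] at h1
  have h2 : -(‖G‖ * ‖x‖) ≤ ⟪G, x⟫ := (abs_le.1 (abs_real_inner_le_norm G x)).1
  have h3 : 0 ≤ (1 - ‖x‖) * (‖G‖ - w * (1 + ‖x‖) / 2) :=
    mul_nonneg (by linarith [hx.1]) (by nlinarith [hx.1])
  have h4 : ‖(-‖G‖⁻¹) • G - x‖ ^ 2 ≤ 0 := by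
    by_contra! h5
    nlinarith
  have h6 : ‖(-‖G‖⁻¹) • G - x‖ = 0 := pow_eq_zero_iff two_ne_zero |>.1 (le_antisymm h4 (sq_nonneg _))
  exact (sub_eq_zero.1 (norm_eq_zero.1 h6)).symm

lemma IsBallMin.step_le {G c x : E} {w : ℝ} (hx : IsBallMin G w x) (hw : 0 < w)
    (hG : w ≤ ‖G‖) : ⟪c, x⟫ + ‖G + c‖ - ‖G‖ ≤ ‖c‖ ^ 2 / (2 * ‖G‖) := by
  have hG' : 0 < ‖G‖ := by linarith
  rw [hx.eq_neg_smul hw hG, inner_smul_right, real_inner_comm]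
  have h1 := norm_add_sq_real G c
  have h2 : ‖G + c‖ * (2 * ‖G‖) ≤ ‖G + c‖ ^ 2 + ‖G‖ ^ 2 := by nlinarith [sq_nonneg (‖G + c‖ - ‖G‖)]
  rw [le_div_iff₀ (by positivity)]
  have h3 : (-‖G‖⁻¹ * ⟪G, c⟫ + ‖G + c‖ - ‖G‖) * (2 * ‖G‖)
      = -2 * ⟪G, c⟫ + ‖G + c‖ * (2 * ‖G‖) - 2 * ‖G‖ ^ 2 := by
    field_simp
  rw [h3]
  linarith

end Ball

/-! ### Cumulative quantities -/

section Cumulative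

variable {E : Type*} [NormedAddCommGroup E]

/-- The sum of the first `t` costs. -/
def cumCost (c : ℕ → E) (t : ℕ) : E := ∑ s ∈ Finset.Icc 1 t, c s

/-- One plus the sum of the squared norms of the first `t` costs. -/
noncomputable def energy (c : ℕ → E) (t : ℕ) : ℝ := 1 + ∑ s ∈ Finset.Icc 1 t, ‖c s‖ ^ 2

lemma cumCost_succ (c : ℕ → E) (t : ℕ) : cumCost c (t + 1) = cumCost c t + c (t + 1) :=
  Finset.sum_Icc_succ_top (by omega) _

lemma energy_succ (c : ℕ → E) (t : ℕ) : energy c (t + 1) = energy c t + ‖c (t + 1)‖ ^ 2 := by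
  rw [energy, energy, Finset.sum_Icc_succ_top (by omega), add_assoc]

@[simp] lemma cumCost_zero (c : ℕ → E) : cumCost c 0 = 0 := by simp [cumCost]

@[simp] lemma energy_zero (c : ℕ → E) : energy c 0 = 1 := by simp [energy]

lemma one_le_energy (c : ℕ → E) (t : ℕ) : 1 ≤ energy c t :=
  le_add_of_nonneg_right (Finset.sum_nonneg fun _ _ => sq_nonneg _)

lemma energy_pos (c : ℕ → E) (t : ℕ) : 0 < energy c t :=
  zero_lt_one.trans_le (one_le_energy c t)

lemma energy_mono (c : ℕ → E) : Monotone (energy c) :=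
  monotone_nat_of_le_succ fun t => by
    rw [energy_succ]
    exact le_add_of_nonneg_right (sq_nonneg _)

lemma sqrt_energy_le_succ (c : ℕ → E) (t : ℕ) : √(energy c t) ≤ √(energy c (t + 1)) :=
  Real.sqrt_le_sqrt (energy_mono c (Nat.le_succ t))

/-! ### Follow the regularized leader -/

variable [InnerProductSpace ℝ E]

/-- The cumulative loss of the iterates `x` in the first `t` rounds. -/
noncomputable def cumLoss (c x : ℕ → E) (t : ℕ) : ℝ := ∑ s ∈ Finset.Icc 1 t, ⟪c s, x s⟫

lemma cumLoss_succ (c x : ℕ → E) (t : ℕ) :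
    cumLoss c x (t + 1) = cumLoss c x t + ⟪c (t + 1), x (t + 1)⟫ :=
  Finset.sum_Icc_succ_top (by omega) _

@[simp] lemma cumLoss_zero (c x : ℕ → E) : cumLoss c x 0 = 0 := by simp [cumLoss]

/-- The optimal value of the regularized problem solved after round `t`. -/
noncomputable def ftrlValue (c x : ℕ → E) (t : ℕ) : ℝ :=
  ⟪cumCost c t, x (t + 1)⟫ + √(energy c t) / 2 * ‖x (t + 1)‖ ^ 2

variable {c x : ℕ → E} {T : ℕ}

lemma ftrl_regret_le (hc : ∀ t < T, ‖c (t + 1)‖ ≤ 1) (hx1 : x 1 = 0)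
    (hx : ∀ t ≤ T, IsBallMin (cumCost c t) (√(energy c t)) (x (t + 1))) {t : ℕ} (ht : t ≤ T) :
    cumLoss c x t + ‖cumCost c t‖ ≤ 2 * √(energy c t) := by
  have h1 : cumLoss c x t - cumLoss c x 0 ≤
      (ftrlValue c x t + 3 / 2 * √(energy c t)) - (ftrlValue c x 0 + 3 / 2 * √(energy c 0)) := by
    refine sub_le_sub_of_step_le (g := fun t => ftrlValue c x t + 3 / 2 * √(energy c t))
      (Nat.zero_le t) fun s _ hs => ?_
    have h2 := hx (s + 1) (by omega)
    rw [cumCost_succ] at h2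
    have h3 := (hx s (by omega)).inner_le h2 (Real.sqrt_pos.2 (energy_pos c s))
      (sqrt_energy_le_succ c s)
    have h4 := div_sqrt_le_three_mul_sqrt_sub_sqrt (one_le_energy c s)
      (sq_nonneg ‖c (s + 1)‖) (pow_le_one₀ (norm_nonneg _) (hc s (by omega)))
    rw [← energy_succ] at h4
    have h5 : ‖c (s + 1)‖ ^ 2 / (2 * √(energy c s)) = ‖c (s + 1)‖ ^ 2 / √(energy c s) / 2 := by
      rw [mul_comm, div_mul_eq_div_div]
    simp only [ftrlValue, cumLoss_succ, cumCost_succ]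
    linarith
  have h6 := (hx t ht).value_le (Real.sqrt_nonneg _)
  simp only [ftrlValue, cumLoss_zero, cumCost_zero, energy_zero, Real.sqrt_one, zero_add, hx1,
    norm_zero, inner_zero_right] at h1
  norm_num at h1
  linarith

lemma le_cumLoss (hx1 : x 1 = 0)
    (hx : ∀ t ≤ T, IsBallMin (cumCost c t) (√(energy c t)) (x (t + 1))) {t : ℕ} (ht : t ≤ T) :
    -‖cumCost c t‖ - √(energy c t) / 2 ≤ cumLoss c x t := by
  have h1 : (ftrlValue c x t - √(energy c t) / 2) - (ftrlValue c x 0 - √(energy c 0) / 2) ≤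
      cumLoss c x t - cumLoss c x 0 := by
    refine sub_le_sub_of_step_le (A := fun t => ftrlValue c x t - √(energy c t) / 2)
      (Nat.zero_le t) fun s _ hs => ?_
    have h2 := hx (s + 1) (by omega)
    rw [cumCost_succ] at h2
    have h3 := (hx s (by omega)).le_inner h2 (sqrt_energy_le_succ c s)
    simp only [ftrlValue, cumLoss_succ, cumCost_succ]
    linarith
  have h4 : -‖cumCost c t‖ ≤ ftrlValue c x t := by
    have h5 := neg_norm_le_inner (G := cumCost c t) (hx t ht).1
    have h6 : 0 ≤ √(energy c t) / 2 * ‖x (t + 1)‖ ^ 2 := by positivity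
    rw [ftrlValue]
    linarith
  simp only [ftrlValue, cumLoss_zero, cumCost_zero, energy_zero, Real.sqrt_one, hx1,
    norm_zero, inner_zero_right] at h1
  norm_num at h1
  rw [ftrlValue] at h4
  linarith

/-- Once the loss of the iterates is very negative, the leader is far from the origin. -/
lemma le_norm_cumCost {α : ℝ} (hα0 : 0 < α) (hα1 : α ≤ 1) (hx1 : x 1 = 0)
    (hx : ∀ t ≤ T, IsBallMin (cumCost c t) (√(energy c t)) (x (t + 1))) {t : ℕ} (ht : t ≤ T)
    (hlarge : 10 / α ≤ √(energy c t))
    (hneg : cumLoss c x t ≤ -(α * (energy c t - 1) / 2)) :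
    √(energy c t) ≤ ‖cumCost c t‖ ∧ α * energy c t / 3 ≤ ‖cumCost c t‖ := by
  have h1 := le_cumLoss hx1 hx ht
  have h2 : √(energy c t) ^ 2 = energy c t := Real.sq_sqrt (energy_pos c t).le
  have h3 : 1 ≤ √(energy c t) := Real.one_le_sqrt.2 (one_le_energy c t)
  rw [div_le_iff₀ hα0] at hlarge
  have h4 : 10 * √(energy c t) ≤ α * energy c t := by nlinarith
  constructor <;> linarith

lemma late_regret_le {α : ℝ} (hα0 : 0 < α) (hα1 : α ≤ 1) (hc : ∀ t < T, ‖c (t + 1)‖ ≤ 1)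
    (hx1 : x 1 = 0)
    (hx : ∀ t ≤ T, IsBallMin (cumCost c t) (√(energy c t)) (x (t + 1))) {τ : ℕ} (hτ : τ ≤ T)
    (hlate : ∀ t, τ < t → t ≤ T → 10 / α ≤ √(energy c t) ∧
      cumLoss c x t ≤ -(α * (energy c t - 1) / 2)) :
    cumLoss c x T + ‖cumCost c T‖ ≤ cumLoss c x τ + ‖cumCost c τ‖ + 2
      + 3 / α * (Real.log (energy c T) - Real.log (energy c τ)) := by
  rcases hτ.eq_or_lt with rfl | hlt
  · simp
  have h1 : (cumLoss c x T + ‖cumCost c T‖) - (cumLoss c x (τ + 1) + ‖cumCost c (τ + 1)‖) ≤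
      3 / α * Real.log (energy c T) - 3 / α * Real.log (energy c (τ + 1)) := by
    refine sub_le_sub_of_step_le (A := fun t => cumLoss c x t + ‖cumCost c t‖)
      (g := fun t => 3 / α * Real.log (energy c t)) hlt fun s hs hsT => ?_
    obtain ⟨ha, hb⟩ := hlate s (by omega) (by omega)
    obtain ⟨h2, h3⟩ := le_norm_cumCost hα0 hα1 hx1 hx (by omega : s ≤ T) ha hb
    have hV := energy_pos c s
    have h4 := (hx s (by omega)).step_le (c := c (s + 1)) (Real.sqrt_pos.2 hV) h2
    have h5 : ‖c (s + 1)‖ ^ 2 / (2 * ‖cumCost c s‖) ≤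
        3 / (2 * α) * (‖c (s + 1)‖ ^ 2 / energy c s) := by
      rw [div_mul_div_comm]
      have h6 : 3 * ‖c (s + 1)‖ ^ 2 / (2 * α * energy c s)
          = ‖c (s + 1)‖ ^ 2 / (2 * (α * energy c s / 3)) := by
        field_simp
      rw [h6]
      gcongr
    have h7 := div_le_two_mul_log_sub_log (one_le_energy c s)
      (sq_nonneg ‖c (s + 1)‖) (pow_le_one₀ (norm_nonneg _) (hc s (by omega)))
    rw [← energy_succ] at h7
    have h8 : 3 / (2 * α) * (‖c (s + 1)‖ ^ 2 / energy c s) ≤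
        3 / (2 * α) * (2 * (Real.log (energy c (s + 1)) - Real.log (energy c s))) :=
      mul_le_mul_of_nonneg_left h7 (by positivity)
    have h9 : 3 / (2 * α) * (2 * (Real.log (energy c (s + 1)) - Real.log (energy c s))) =
        3 / α * Real.log (energy c (s + 1)) - 3 / α * Real.log (energy c s) := by
      field_simp
    simp only [cumLoss_succ, cumCost_succ]
    linarith
  have h10 : ⟪c (τ + 1), x (τ + 1)⟫ ≤ 1 :=
    (real_inner_le_norm _ _).trans
      (mul_le_one₀ (hc τ hlt) (norm_nonneg _) (hx τ hτ).1)
  have h11 := norm_add_le (cumCost c τ) (c (τ + 1))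
  have h12 := hc τ hlt
  have h13 : 3 / α * Real.log (energy c τ) ≤ 3 / α * Real.log (energy c (τ + 1)) :=
    mul_le_mul_of_nonneg_left
      (Real.log_le_log (energy_pos c τ) (energy_mono c (Nat.le_succ τ))) (by positivity)
  rw [cumLoss_succ, cumCost_succ] at h1
  linarith

end Cumulative

/-! ### Online gradient descent on the query probabilities -/

section Query

variable {E : Type*} [NormedAddCommGroup E] {c x : ℕ → E} {T : ℕ} {α : ℝ} {p z : ℕ → ℝ}

lemma ogd_bounds (hα0 : 0 < α) (hp1 : p 1 = 0)
    (hp : ∀ t < T, p (t + 2) = max 0 (min (min 1 ((10 / α) / √(energy c (t + 1))))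
      (p (t + 1) - (10 / α) / energy c (t + 1) * z (t + 1)))) {t : ℕ} (ht : t ≤ T) :
    0 ≤ p (t + 1) ∧ p (t + 1) ≤ (10 / α) / √(energy c t) := by
  rcases t with _ | t
  · simp only [zero_add, hp1, energy_zero]
    exact ⟨le_rfl, by positivity⟩
  · rw [hp t (by omega)]
    exact ⟨le_max_left _ _, max_le (by positivity) ((min_le_left _ _).trans (min_le_right _ _))⟩

lemma ogd_step_le (hα0 : 0 < α) {V s P P' Z q : ℝ} (hV : 1 ≤ V) (hs : 0 ≤ s) (hs1 : s ≤ 1)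
    (hZ : Z ^ 2 ≤ 4 * s) (hP0 : 0 ≤ P) (hP : P ≤ (10 / α) / √V)
    (hP' : P' = max 0 (min (min 1 ((10 / α) / √(V + s))) (P - (10 / α) / (V + s) * Z)))
    (hq0 : 0 ≤ q) (hq1 : q ≤ 1) (hq : q ≤ (10 / α) / √(V + s)) :
    Z * (P - q) ≤ (30 / α * Real.log (V + s) - α / 20 * ((V + s) * (P' - q) ^ 2))
      - (30 / α * Real.log V - α / 20 * (V * (P - q) ^ 2)) := by
  have hV0 : 0 < V := by linarith
  have hVs : 0 < V + s := by linarith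
  have h1 : (P' - q) ^ 2 ≤ (P - (10 / α) / (V + s) * Z - q) ^ 2 := by
    rw [hP']
    exact sq_clip_sub_le hq0 (le_min hq1 hq)
  have h2 : Z * (P - q) ≤ 20 / α * (s / (V + s)) + α / 20 * ((V + s) * (P - q) ^ 2)
      - α / 20 * ((V + s) * (P' - q) ^ 2) := by
    have h3 : α / 20 * ((V + s) * (P' - q) ^ 2) ≤
        α / 20 * ((V + s) * (P - (10 / α) / (V + s) * Z - q) ^ 2) := by gcongr
    have h4 : α / 20 * ((V + s) * (P - (10 / α) / (V + s) * Z - q) ^ 2) =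
        α / 20 * ((V + s) * (P - q) ^ 2) - Z * (P - q) + 5 / α * (Z ^ 2 / (V + s)) := by
      field_simp
      ring
    have h5 : 5 / α * (Z ^ 2 / (V + s)) ≤ 5 / α * (4 * s / (V + s)) := by gcongr
    have h6 : 5 / α * (4 * s / (V + s)) = 20 / α * (s / (V + s)) := by ring
    linarith
  have h7 : q ≤ (10 / α) / √V :=
    hq.trans (div_le_div_of_nonneg_left (by positivity) (Real.sqrt_pos.2 hV0)
      (Real.sqrt_le_sqrt (by linarith)))
  have h8 : (P - q) ^ 2 ≤ ((10 / α) / √V) ^ 2 := by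
    apply sq_le_sq'
    · linarith
    · linarith
  have h9 : α / 20 * (s * (P - q) ^ 2) ≤ 5 / α * (s / V) := by
    have h10 : α / 20 * (s * (P - q) ^ 2) ≤ α / 20 * (s * ((10 / α) / √V) ^ 2) := by gcongr
    have h11 : α / 20 * (s * ((10 / α) / √V) ^ 2) = 5 / α * (s / V) := by
      rw [div_pow, Real.sq_sqrt hV0.le]
      field_simp
      ring
    linarith
  have h12 := mul_le_mul_of_nonneg_left (div_add_le_log_sub_log hV0 hs)
    (by positivity : 0 ≤ 20 / α)
  have h13 := mul_le_mul_of_nonneg_left (div_le_two_mul_log_sub_log hV hs hs1)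
    (by positivity : 0 ≤ 5 / α)
  have h14 : 20 / α * (Real.log (V + s) - Real.log V) + 5 / α * (2 * (Real.log (V + s) - Real.log V))
      = 30 / α * Real.log (V + s) - 30 / α * Real.log V := by
    ring
  linarith

lemma ogd_regret_le (hα0 : 0 < α) (hc : ∀ t < T, ‖c (t + 1)‖ ≤ 1)
    (hz : ∀ t < T, z (t + 1) ^ 2 ≤ 4 * ‖c (t + 1)‖ ^ 2)
    (hpb : ∀ t ≤ T, 0 ≤ p (t + 1) ∧ p (t + 1) ≤ (10 / α) / √(energy c t))
    (hp : ∀ t < T, p (t + 2) = max 0 (min (min 1 ((10 / α) / √(energy c (t + 1))))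
      (p (t + 1) - (10 / α) / energy c (t + 1) * z (t + 1)))) {m n : ℕ} (hmn : m ≤ n)
    (hn : n ≤ T) {q : ℝ} (hq0 : 0 ≤ q) (hq1 : q ≤ 1) (hq : q ≤ (10 / α) / √(energy c n)) :
    ∑ s ∈ Finset.Icc 1 n, z s * (p s - q) - ∑ s ∈ Finset.Icc 1 m, z s * (p s - q) ≤
      (30 / α * Real.log (energy c n) - α / 20 * (energy c n * (p (n + 1) - q) ^ 2)) -
      (30 / α * Real.log (energy c m) - α / 20 * (energy c m * (p (m + 1) - q) ^ 2)) := by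
  refine sub_le_sub_of_step_le (A := fun k => ∑ s ∈ Finset.Icc 1 k, z s * (p s - q))
    (g := fun k => 30 / α * Real.log (energy c k) - α / 20 * (energy c k * (p (k + 1) - q) ^ 2))
    hmn fun t _ ht => ?_
  have hqt : q ≤ (10 / α) / √(energy c (t + 1)) :=
    hq.trans (div_le_div_of_nonneg_left (by positivity) (Real.sqrt_pos.2 (energy_pos c _))
      (Real.sqrt_le_sqrt (energy_mono c ht)))
  have hpt := hp t (by omega)
  rw [energy_succ] at hqt hpt
  have h1 := ogd_step_le hα0 (one_le_energy c t) (sq_nonneg ‖c (t + 1)‖)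
    (pow_le_one₀ (norm_nonneg _) (hc t (by omega))) (hz t (by omega)) (hpb t (by omega)).1
    (hpb t (by omega)).2 hpt hq0 hq1 hqt
  rw [← energy_succ] at h1
  simp only [Finset.sum_Icc_succ_top (Nat.le_add_left 1 t), add_sub_cancel_left]
  exact h1

lemma sum_query_le (hα0 : 0 < α) (hc : ∀ t < T, ‖c (t + 1)‖ ≤ 1)
    (hpb : ∀ t ≤ T, 0 ≤ p (t + 1) ∧ p (t + 1) ≤ (10 / α) / √(energy c t))
    {B : Finset ℕ} (hB : B ⊆ Finset.Icc 1 T) :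
    ∑ t ∈ B, p t * (α * ‖c t‖ ^ 2) ≤ 20 * √(∑ t ∈ B, ‖c t‖ ^ 2) := by
  classical
  set b : ℕ → ℝ := fun t => if t ∈ B then ‖c t‖ ^ 2 else 0 with hb
  have hb0 : ∀ t, 0 ≤ b t := fun t => by
    simp only [hb]
    split_ifs <;> positivity
  have hbc : ∀ t, b t ≤ ‖c t‖ ^ 2 := fun t => by
    simp only [hb]
    split_ifs
    · exact le_rfl
    · positivity
  have hsum : ∀ f : ℕ → ℝ, ∑ t ∈ B, f t = ∑ t ∈ Finset.Icc 1 T, if t ∈ B then f t else 0 :=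
    fun f => by rw [← Finset.sum_filter, Finset.filter_mem_eq_inter, Finset.inter_eq_right.2 hB]
  have h1 : ∑ t ∈ Finset.Icc 1 T, p t * (α * b t) - ∑ t ∈ Finset.Icc 1 0, p t * (α * b t) ≤
      20 * √(∑ t ∈ Finset.Icc 1 T, b t) - 20 * √(∑ t ∈ Finset.Icc 1 0, b t) := by
    refine sub_le_sub_of_step_le (A := fun k => ∑ t ∈ Finset.Icc 1 k, p t * (α * b t))
      (g := fun k => 20 * √(∑ t ∈ Finset.Icc 1 k, b t)) (Nat.zero_le T) fun t _ ht => ?_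
    simp only [Finset.sum_Icc_succ_top (Nat.le_add_left 1 t), add_sub_cancel_left]
    have h2 : ∑ s ∈ Finset.Icc 1 t, b s + b (t + 1) ≤ energy c t := by
      have h3 : ∑ s ∈ Finset.Icc 1 t, b s ≤ ∑ s ∈ Finset.Icc 1 t, ‖c s‖ ^ 2 :=
        Finset.sum_le_sum fun s _ => hbc s
      have h4 : b (t + 1) ≤ 1 := (hbc _).trans (pow_le_one₀ (norm_nonneg _) (hc t ht))
      rw [energy]
      linarith
    have h5 := div_sqrt_le_two_mul_sqrt_sub_sqrt (energy_pos c t)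
      (Finset.sum_nonneg fun s _ => hb0 s) (hb0 (t + 1)) h2
    have h6 : p (t + 1) * (α * b (t + 1)) ≤ (10 / α) / √(energy c t) * (α * b (t + 1)) :=
      mul_le_mul_of_nonneg_right (hpb t ht.le).2 (mul_nonneg hα0.le (hb0 _))
    have h7 : (10 / α) / √(energy c t) * (α * b (t + 1)) = 10 * (b (t + 1) / √(energy c t)) := by
      field_simp
    linarith
  rw [hsum, hsum]
  simpa [hb] using h1

lemma sum_sq_query_le (hα0 : 0 < α) (hc : ∀ t < T, ‖c (t + 1)‖ ≤ 1)
    (hpb : ∀ t ≤ T, 0 ≤ p (t + 1) ∧ p (t + 1) ≤ (10 / α) / √(energy c t)) :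
    ∑ t ∈ Finset.Icc 1 T, (p t * ‖c t‖) ^ 2 ≤ 200 / α ^ 2 * Real.log (energy c T) := by
  have h1 : ∑ t ∈ Finset.Icc 1 T, (p t * ‖c t‖) ^ 2 - ∑ t ∈ Finset.Icc 1 0, (p t * ‖c t‖) ^ 2 ≤
      200 / α ^ 2 * Real.log (energy c T) - 200 / α ^ 2 * Real.log (energy c 0) := by
    refine sub_le_sub_of_step_le (A := fun k => ∑ t ∈ Finset.Icc 1 k, (p t * ‖c t‖) ^ 2)
      (g := fun k => 200 / α ^ 2 * Real.log (energy c k)) (Nat.zero_le T) fun t _ ht => ?_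
    simp only [Finset.sum_Icc_succ_top (Nat.le_add_left 1 t), add_sub_cancel_left]
    obtain ⟨h2, h3⟩ := hpb t ht.le
    have h4 : (p (t + 1) * ‖c (t + 1)‖) ^ 2 ≤ ((10 / α) / √(energy c t) * ‖c (t + 1)‖) ^ 2 := by
      gcongr
    have h5 : ((10 / α) / √(energy c t) * ‖c (t + 1)‖) ^ 2
        = 100 / α ^ 2 * (‖c (t + 1)‖ ^ 2 / energy c t) := by
      rw [mul_pow, div_pow, Real.sq_sqrt (energy_pos c t).le]
      ring
    have h6 := mul_le_mul_of_nonneg_left (div_le_two_mul_log_sub_log (one_le_energy c t)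
      (sq_nonneg ‖c (t + 1)‖) (pow_le_one₀ (norm_nonneg _) (hc t ht)))
      (by positivity : 0 ≤ 100 / α ^ 2)
    rw [← energy_succ] at h6
    have h7 : 100 / α ^ 2 * (2 * (Real.log (energy c (t + 1)) - Real.log (energy c t))) =
        200 / α ^ 2 * Real.log (energy c (t + 1)) - 200 / α ^ 2 * Real.log (energy c t) := by ring
    linarith
  simpa using h1

/-- The contribution of the rounds in `B` when hints are only bounded in norm. -/
lemma sum_query_mul_norm_le (hα0 : 0 < α) (hc : ∀ t < T, ‖c (t + 1)‖ ≤ 1)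
    (hpb : ∀ t ≤ T, 0 ≤ p (t + 1) ∧ p (t + 1) ≤ (10 / α) / √(energy c t))
    {B : Finset ℕ} (hB : B ⊆ Finset.Icc 1 T) (h : ℕ → E) :
    ∑ t ∈ B, p t * ‖c t‖ * ‖h t‖ ≤
      20 / α * √(∑ t ∈ B, ‖h t‖ ^ 2) * √(Real.log (energy c T)) := by
  have h1 := Real.sum_mul_le_sqrt_mul_sqrt B (fun t => p t * ‖c t‖) fun t => ‖h t‖
  have h2 : ∑ t ∈ B, (p t * ‖c t‖) ^ 2 ≤ (20 / α) ^ 2 * Real.log (energy c T) := by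
    have h3 := Finset.sum_le_sum_of_subset_of_nonneg (f := fun t => (p t * ‖c t‖) ^ 2) hB
      fun _ _ _ => sq_nonneg _
    have h4 := sum_sq_query_le hα0 hc hpb
    have h5 : 200 / α ^ 2 * Real.log (energy c T) ≤ (20 / α) ^ 2 * Real.log (energy c T) := by
      have h6 := Real.log_nonneg (one_le_energy c T)
      rw [div_pow]
      gcongr
      norm_num
    linarith
  have h7 : √(∑ t ∈ B, (p t * ‖c t‖) ^ 2) ≤ 20 / α * √(Real.log (energy c T)) := by
    refine (Real.sqrt_le_sqrt h2).trans_eq ?_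
    rw [Real.sqrt_mul (by positivity), Real.sqrt_sq (by positivity)]
  calc ∑ t ∈ B, p t * ‖c t‖ * ‖h t‖
      ≤ √(∑ t ∈ B, (p t * ‖c t‖) ^ 2) * √(∑ t ∈ B, ‖h t‖ ^ 2) := h1
    _ ≤ 20 / α * √(Real.log (energy c T)) * √(∑ t ∈ B, ‖h t‖ ^ 2) := by gcongr
    _ = _ := by ring

end Query

/-! ### Combining the two learners -/

section Regret

variable {E : Type*} [NormedAddCommGroup E] [InnerProductSpace ℝ E] {c x : ℕ → E} {T : ℕ}
  {α : ℝ} {p z : ℕ → ℝ}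

lemma sum_eq_neg_cumLoss (hz : ∀ t, z t = -(α * ‖c t‖ ^ 2) - ⟪c t, x t⟫) (t : ℕ) :
    ∑ s ∈ Finset.Icc 1 t, z s = -(α * (energy c t - 1)) - cumLoss c x t := by
  simp only [hz, Finset.sum_sub_distrib, Finset.sum_neg_distrib, ← Finset.mul_sum, energy, cumLoss,
    add_sub_cancel_left]

lemma sq_le_of_norm_le_one (hα0 : 0 < α) (hα1 : α ≤ 1) {a y : E} (ha : ‖a‖ ≤ 1) (hy : ‖y‖ ≤ 1) :
    (-(α * ‖a‖ ^ 2) - ⟪a, y⟫) ^ 2 ≤ 4 * ‖a‖ ^ 2 := by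
  have h1 := abs_le.1 (abs_real_inner_le_norm a y)
  have h2 : ‖a‖ * ‖y‖ ≤ ‖a‖ := mul_le_of_le_one_right (norm_nonneg a) hy
  have h3 : α * ‖a‖ ^ 2 ≤ ‖a‖ := by nlinarith [norm_nonneg a, mul_le_one₀ hα1 (norm_nonneg a) ha]
  have h4 : 0 ≤ α * ‖a‖ ^ 2 := by positivity
  have h5 : (-(α * ‖a‖ ^ 2) - ⟪a, y⟫) ^ 2 ≤ (2 * ‖a‖) ^ 2 :=
    sq_le_sq' (by linarith) (by linarith)
  linarith [mul_pow 2 ‖a‖ 2]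

/-- Up to a round where the iterates have not done too well, some fixed query probability
compensates the regret of the iterates. -/
lemma exists_query_probability (hα0 : 0 < α) (hα1 : α ≤ 1)
    (hz : ∀ t, z t = -(α * ‖c t‖ ^ 2) - ⟪c t, x t⟫) {t : ℕ}
    (hreg : cumLoss c x t + ‖cumCost c t‖ ≤ 2 * √(energy c t))
    (ht : √(energy c t) < 10 / α ∨ -(α * (energy c t - 1) / 2) < cumLoss c x t) :
    ∃ q, 0 ≤ q ∧ q ≤ 1 ∧ q ≤ (10 / α) / √(energy c t) ∧
      cumLoss c x t + ‖cumCost c t‖ + q * ∑ s ∈ Finset.Icc 1 t, z s ≤ 20 / α := by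
  by_cases hs : √(energy c t) < 10 / α
  · refine ⟨0, le_rfl, zero_le_one, by positivity, ?_⟩
    have h1 : 2 * (10 / α) = 20 / α := by ring
    linarith
  · have hw : 0 < √(energy c t) := Real.sqrt_pos.2 (energy_pos c t)
    refine ⟨(10 / α) / √(energy c t), by positivity, (div_le_one hw).2 (not_lt.1 hs), le_rfl, ?_⟩
    rw [sum_eq_neg_cumLoss hz]
    have h1 := ht.resolve_left hs
    have hw1 : 1 ≤ √(energy c t) := Real.one_le_sqrt.2 (one_le_energy c t)
    have h2 : (10 / α) / √(energy c t) * (-(α * (energy c t - 1)) - cumLoss c x t) ≤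
        (10 / α) / √(energy c t) * (-(α * (energy c t - 1) / 2)) :=
      mul_le_mul_of_nonneg_left (by linarith) (by positivity)
    have h3 : (10 / α) / √(energy c t) * (-(α * (energy c t - 1) / 2)) =
        -5 * √(energy c t) + 5 / √(energy c t) := by
      nth_rewrite 2 [← Real.sq_sqrt (energy_pos c t).le]
      field_simp
      ring
    have h4 : 5 / √(energy c t) ≤ 5 := div_le_self (by norm_num) hw1
    have h5 : 20 ≤ 20 / α := by
      rw [le_div_iff₀ hα0]
      linarith
    linarith

/-- The regret of the iterates together with the losses of the query probabilities is logarithmic. -/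
lemma combined_regret_le (hα0 : 0 < α) (hα1 : α ≤ 1) (hc : ∀ t < T, ‖c (t + 1)‖ ≤ 1)
    (hx1 : x 1 = 0)
    (hx : ∀ t ≤ T, IsBallMin (cumCost c t) (√(energy c t)) (x (t + 1)))
    (hz : ∀ t, z t = -(α * ‖c t‖ ^ 2) - ⟪c t, x t⟫) (hp1 : p 1 = 0)
    (hp : ∀ t < T, p (t + 2) = max 0 (min (min 1 ((10 / α) / √(energy c (t + 1))))
      (p (t + 1) - (10 / α) / energy c (t + 1) * z (t + 1)))) :
    cumLoss c x T + ‖cumCost c T‖ + ∑ s ∈ Finset.Icc 1 T, z s * p s ≤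
      (28 + 33 * Real.log (energy c T)) / α := by
  have hpb : ∀ t ≤ T, 0 ≤ p (t + 1) ∧ p (t + 1) ≤ (10 / α) / √(energy c t) :=
    fun t ht => ogd_bounds hα0 hp1 hp ht
  have hzsq : ∀ t < T, z (t + 1) ^ 2 ≤ 4 * ‖c (t + 1)‖ ^ 2 := fun t ht => by
    rw [hz]
    exact sq_le_of_norm_le_one hα0 hα1 (hc t ht) (hx t ht.le).1
  obtain ⟨τ, hτT, hτ, hlast⟩ := exists_last
    (P := fun t => √(energy c t) < 10 / α ∨ -(α * (energy c t - 1) / 2) < cumLoss c x t)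
    (by
      left
      rw [energy_zero, Real.sqrt_one, lt_div_iff₀ hα0]
      linarith) T
  have hlate := late_regret_le hα0 hα1 hc hx1 hx hτT fun t h1 h2 => by
    simpa only [not_or, not_lt] using hlast t h1 h2
  obtain ⟨q, hq0, hq1, hq, hqle⟩ :=
    exists_query_probability hα0 hα1 hz (ftrl_regret_le hc hx1 hx hτT) hτ
  have h1 := ogd_regret_le hα0 hc hzsq hpb hp (Nat.zero_le τ) hτT hq0 hq1 hq
  have h2 := ogd_regret_le (q := 0) hα0 hc hzsq hpb hp hτT le_rfl le_rfl zero_le_one (by positivity)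
  have hsplit : ∑ s ∈ Finset.Icc 1 τ, z s * (p s - q)
      = ∑ s ∈ Finset.Icc 1 τ, z s * p s - q * ∑ s ∈ Finset.Icc 1 τ, z s := by
    rw [Finset.mul_sum, ← Finset.sum_sub_distrib]
    exact Finset.sum_congr rfl fun s _ => by ring
  rw [hsplit] at h1
  simp only [zero_add, hp1, energy_zero, Real.log_one, zero_lt_one, Finset.Icc_eq_empty_of_lt,
    Finset.sum_empty, sub_zero, zero_sub, mul_zero, one_mul, neg_sq, sub_neg_eq_add] at h1
  simp only [sub_zero] at h2
  have h3 : α / 20 * q ^ 2 ≤ 1 / α := by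
    have h4 : q ^ 2 ≤ 1 := pow_le_one₀ hq0 hq1
    have h5 : 1 ≤ 1 / α := by
      rw [le_div_iff₀ hα0]
      linarith
    nlinarith
  have h6 : 0 ≤ α / 20 * (energy c τ * (p (τ + 1) - q) ^ 2) :=
    mul_nonneg (by positivity) (mul_nonneg (energy_pos c τ).le (sq_nonneg _))
  have h7 : 0 ≤ α / 20 * (energy c T * p (T + 1) ^ 2) :=
    mul_nonneg (by positivity) (mul_nonneg (energy_pos c T).le (sq_nonneg _))
  have h8 : α / 20 * (energy c τ * p (τ + 1) ^ 2) ≤ 5 / α := by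
    obtain ⟨h9, h10⟩ := hpb τ hτT
    have hV := energy_pos c τ
    have h11 : α / 20 * (energy c τ * p (τ + 1) ^ 2) ≤
        α / 20 * (energy c τ * ((10 / α) / √(energy c τ)) ^ 2) := by gcongr
    have h12 : α / 20 * (energy c τ * ((10 / α) / √(energy c τ)) ^ 2) = 5 / α := by
      rw [div_pow, Real.sq_sqrt hV.le]
      field_simp
      ring
    linarith
  have h13 : 0 ≤ 3 / α * Real.log (energy c τ) :=
    mul_nonneg (by positivity) (Real.log_nonneg (one_le_energy c τ))
  have h14 : 2 ≤ 2 / α := by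
    rw [le_div_iff₀ hα0]
    linarith
  have h15 : (28 + 33 * Real.log (energy c T)) / α = 20 / α + 1 / α + 5 / α + 2 / α
      + 30 / α * Real.log (energy c T) + 3 / α * Real.log (energy c T) := by ring
  linarith

/-- The loss of a round, with a correction term if the hint is bad. -/
lemma round_loss_le {β P : ℝ} (hP : 0 ≤ P) (a k y : E) :
    P * ⟪a, -k⟫ + (1 - P) * ⟪a, y⟫ ≤ ⟪a, y⟫ + (-β - ⟪a, y⟫) * P +
      if ⟪a, k⟫ < β then P * β + P * ‖a‖ * ‖k‖ else 0 := by
  rw [inner_neg_right]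
  split_ifs with h
  · have h1 := (abs_le.1 (abs_real_inner_le_norm a k)).1
    nlinarith
  · nlinarith

end Regret

/-- Theorem 4.1: with bad hints `𝓑 = {t : ⟨c_t,h_t⟩ < α‖c_t‖²}`, the
hint-querying algorithm has expected regret at most
`(78 + 38 log(1+σ_{1:T}))/α + 40·√(Σ_{t∈𝓑}‖c_t‖²) + (20/α)·√(Σ_{t∈𝓑}‖h_t‖²)·√(log(1+σ_{1:T}))`
and expected query cost at most `20·√(σ_{1:T})`. -/
theorem stmt5 {d T : ℕ} (α : ℝ) (hα0 : 0 < α) (hα1 : α ≤ 1)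
    (c h x : ℕ → Vec d)
    (hc : ∀ t ∈ Finset.Icc 1 T, ‖c t‖ ≤ 1)
    (hh : ∀ t ∈ Finset.Icc 1 T, ‖h t‖ ≤ 1)
    (hx1 : x 1 = 0)
    (hxball : ∀ t ∈ Finset.Icc 1 T, ‖x (t + 1)‖ ≤ 1)
    (hxmin : ∀ t ∈ Finset.Icc 1 T, ∀ y : Vec d, ‖y‖ ≤ 1 →
      ⟪(∑ s ∈ Finset.Icc 1 t, c s), x (t + 1)⟫ +
          Real.sqrt (1 + ∑ s ∈ Finset.Icc 1 t, ‖c s‖ ^ 2) / 2 * ‖x (t + 1)‖ ^ 2 ≤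
        ⟪(∑ s ∈ Finset.Icc 1 t, c s), y⟫ +
          Real.sqrt (1 + ∑ s ∈ Finset.Icc 1 t, ‖c s‖ ^ 2) / 2 * ‖y‖ ^ 2)
    (z : ℕ → ℝ)
    (hz : ∀ t, z t = -(α * ‖c t‖ ^ 2) - ⟪c t, x t⟫)
    (p : ℕ → ℝ) (hp1 : p 1 = 0)
    (hp : ∀ t ∈ Finset.Icc 1 T,
      p (t + 1) =
        max 0 (min (min 1 ((10 / α) / Real.sqrt (1 + ∑ s ∈ Finset.Icc 1 t, ‖c s‖ ^ 2)))
          (p t - (10 / α) / (1 + ∑ s ∈ Finset.Icc 1 t, ‖c s‖ ^ 2) * z t)))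
    (B : Finset ℕ)
    (hB : B = (Finset.Icc 1 T).filter fun t => ⟪c t, h t⟫ < α * ‖c t‖ ^ 2) :
    (∀ u : Vec d, ‖u‖ ≤ 1 →
        ∑ t ∈ Finset.Icc 1 T,
            (p t * ⟪c t, -h t⟫ + (1 - p t) * ⟪c t, x t⟫ - ⟪c t, u⟫) ≤
          (78 + 38 * Real.log (1 + ∑ s ∈ Finset.Icc 1 T, ‖c s‖ ^ 2)) / α +
            40 * Real.sqrt (∑ t ∈ B, ‖c t‖ ^ 2) +
            20 / α * Real.sqrt (∑ t ∈ B, ‖h t‖ ^ 2) *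
              Real.sqrt (Real.log (1 + ∑ s ∈ Finset.Icc 1 T, ‖c s‖ ^ 2))) ∧
      ∑ t ∈ Finset.Icc 1 T, p t * (α * ‖c t‖ ^ 2) ≤
        20 * Real.sqrt (∑ s ∈ Finset.Icc 1 T, ‖c s‖ ^ 2) := by
  have hc' : ∀ t < T, ‖c (t + 1)‖ ≤ 1 := fun t ht =>
    hc (t + 1) (Finset.mem_Icc.2 ⟨by omega, by omega⟩)
  have hx : ∀ t ≤ T, IsBallMin (cumCost c t) (√(energy c t)) (x (t + 1)) := by
    rintro (_ | t) ht
    · refine ⟨by simp [hx1], fun y _ => ?_⟩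
      simp only [cumCost_zero, energy_zero, zero_add, hx1, inner_zero_left, norm_zero,
        Real.sqrt_one]
      nlinarith [sq_nonneg ‖y‖]
    · have hmem : t + 1 ∈ Finset.Icc 1 T := Finset.mem_Icc.2 ⟨by omega, ht⟩
      exact ⟨hxball _ hmem, hxmin _ hmem⟩
  have hp' : ∀ t < T, p (t + 2) = max 0 (min (min 1 ((10 / α) / √(energy c (t + 1))))
      (p (t + 1) - (10 / α) / energy c (t + 1) * z (t + 1))) := fun t ht =>
    hp (t + 1) (Finset.mem_Icc.2 ⟨by omega, by omega⟩)
  have hpb : ∀ t ≤ T, 0 ≤ p (t + 1) ∧ p (t + 1) ≤ (10 / α) / √(energy c t) :=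
    fun t ht => ogd_bounds hα0 hp1 hp' ht
  refine ⟨fun u hu => ?_, sum_query_le hα0 hc' hpb subset_rfl⟩
  have hBT : B ⊆ Finset.Icc 1 T := hB ▸ Finset.filter_subset _ _
  have hcomb := combined_regret_le hα0 hα1 hc' hx1 hx hz hp1 hp'
  have hbad := sum_query_le hα0 hc' hpb hBT
  have hhint := sum_query_mul_norm_le hα0 hc' hpb hBT h
  have hround : ∑ t ∈ Finset.Icc 1 T, (p t * ⟪c t, -h t⟫ + (1 - p t) * ⟪c t, x t⟫ - ⟪c t, u⟫) ≤
      ∑ t ∈ Finset.Icc 1 T, (⟪c t, x t⟫ + z t * p t + (if ⟪c t, h t⟫ < α * ‖c t‖ ^ 2 then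
        p t * (α * ‖c t‖ ^ 2) + p t * ‖c t‖ * ‖h t‖ else 0) - ⟪c t, u⟫) := by
    refine Finset.sum_le_sum fun t ht => sub_le_sub_right ?_ _
    obtain ⟨ht1, htT⟩ := Finset.mem_Icc.1 ht
    obtain ⟨s, rfl⟩ : ∃ s, t = s + 1 := ⟨t - 1, by omega⟩
    rw [hz]
    exact round_loss_le (hpb s (by omega)).1 _ _ _
  refine hround.trans ?_
  rw [Finset.sum_sub_distrib, Finset.sum_add_distrib, Finset.sum_add_distrib, ← Finset.sum_filter,
    ← hB, Finset.sum_add_distrib, ← sum_inner]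
  have hu' := neg_norm_le_inner (G := cumCost c T) hu
  have hlog := Real.log_nonneg (one_le_energy c T)
  have hconst : (28 + 33 * Real.log (energy c T)) / α ≤ (78 + 38 * Real.log (energy c T)) / α := by
    gcongr <;> norm_num
  have hsqrt := Real.sqrt_nonneg (∑ t ∈ B, ‖c t‖ ^ 2)
  simp only [cumLoss, cumCost, energy] at hcomb hhint hu' hconst
  linarith
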